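/- arXiv:1509.06945 — 4 statements merged into one kernel-verified Lean document; each statement's English description precedes it below -/
import Mathlib

section
/- (Proposition 1, part 2.) For every ξ ∈ ℝ and any values of the parameters μ0 < 0, μ1 > 0, Λ0 > 0, Λ1 > 0, one has n(ξ) < 0. -/
/-- Proposition 1, part 2: n(ξ) < 0 for every ξ. -/
theorem stmt_3
    (μ0 μ1 Λ0 Λ1 : ℝ) (hμ0 : μ0 < 0) (hμ1 : 0 < μ1) (hΛ0 : 0 < Λ0) (hΛ1 : 0 < Λ1)
    (q n : ℝ → ℝ)
    (hq : ∀ ξ, q ξ = (μ0 - μ1)^2 * ξ^2 + 2*(Λ0 - Λ1)*(μ0 - μ1)*ξ + (Λ0 + Λ1)^2)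
    (hn : ∀ ξ, n ξ = (-(μ0 + μ1)*ξ - Real.sqrt (q ξ) - Λ0 - Λ1)/2) :
    ∀ ξ : ℝ, n ξ < 0 := by
  intro ξ
  have hsqrt : |(μ0 - μ1) * ξ + (Λ0 - Λ1)| ≤ Real.sqrt (q ξ) := by
    apply Real.abs_le_sqrt
    rw [hq]
    nlinarith [mul_pos hΛ0 hΛ1]
  obtain ⟨hneg, hpos⟩ := abs_le.mp hsqrt
  rw [hn]
  rcases le_total 0 ξ with hξ | hξ
  · nlinarith [mul_nonneg hμ1.le hξ]
  · nlinarith [mul_nonneg_of_nonpos_of_nonpos hμ0.le hξ]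
end

section
/- (Asymptotic expansion of m at +∞.) As ξ → +∞ one has m(ξ) = −μ0ξ − Λ0 − Λ0Λ1/(ξ(μ0 − μ1)) + o(1/ξ); in particular, ξ·(m(ξ) + μ0ξ + Λ0) tends to −Λ0Λ1/(μ0 − μ1) as ξ → +∞, and m(ξ) + μ0ξ + Λ0 tends to 0 as ξ → +∞. -/
open Filter Asymptotics

/-- The positive root `y` of `y ^ 2 + L * y = c` tends to `0` as `L → ∞`. -/
theorem tendsto_sqrt_sq_add_sub_half {c : ℝ} (hc : 0 ≤ c) :
    Tendsto (fun L : ℝ => (√(L ^ 2 + 4 * c) - L) / 2) atTop (nhds 0) := by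
  refine squeeze_zero' ?_ ?_ (tendsto_id.const_div_atTop c)
  · filter_upwards with L
    have h : L ≤ √(L ^ 2 + 4 * c) := Real.le_sqrt_of_sq_le (by linarith)
    linarith
  · filter_upwards [eventually_gt_atTop 0] with L hL
    have h : L ≤ √(L ^ 2 + 4 * c) := Real.le_sqrt_of_sq_le (by linarith)
    have hs : √(L ^ 2 + 4 * c) ^ 2 = L ^ 2 + 4 * c := Real.sq_sqrt (by positivity)
    rw [id, le_div_iff₀ hL]
    nlinarith [sq_nonneg (√(L ^ 2 + 4 * c) - L)]

theorem tendsto_mul_sqrt_sq_add_sub_half {c : ℝ} (hc : 0 ≤ c) :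
    Tendsto (fun L : ℝ => L * ((√(L ^ 2 + 4 * c) - L) / 2)) atTop (nhds c) := by
  have h := ((tendsto_sqrt_sq_add_sub_half hc).pow 2).const_sub c
  rw [zero_pow two_ne_zero, sub_zero] at h
  refine h.congr fun L => ?_
  have hs : √(L ^ 2 + 4 * c) ^ 2 = L ^ 2 + 4 * c := Real.sq_sqrt (by positivity)
  linear_combination -hs / 4

/-- asymptotic expansion of m at +∞:
m(ξ) = −μ0ξ − Λ0 − Λ0Λ1/(ξ(μ0 − μ1)) + o(1/ξ) as ξ → +∞; in particular
ξ·(m(ξ) + μ0ξ + Λ0) → −Λ0Λ1/(μ0 − μ1) and m(ξ) + μ0ξ + Λ0 → 0. -/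
theorem stmt_9
    (μ0 μ1 Λ0 Λ1 : ℝ) (hμ0 : μ0 < 0) (hμ1 : 0 < μ1) (hΛ0 : 0 < Λ0) (hΛ1 : 0 < Λ1)
    (q m : ℝ → ℝ)
    (hq : ∀ ξ, q ξ = (μ0 - μ1)^2 * ξ^2 + 2*(Λ0 - Λ1)*(μ0 - μ1)*ξ + (Λ0 + Λ1)^2)
    (hm : ∀ ξ, m ξ = (-(μ0 + μ1)*ξ + Real.sqrt (q ξ) - Λ0 - Λ1)/2) :
    (fun ξ : ℝ => m ξ - (-μ0*ξ - Λ0 - Λ0*Λ1/(ξ*(μ0 - μ1)))) =o[atTop] (fun ξ : ℝ => 1/ξ) ∧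
    Tendsto (fun ξ : ℝ => ξ * (m ξ + μ0*ξ + Λ0)) atTop (nhds (-(Λ0*Λ1)/(μ0 - μ1))) ∧
    Tendsto (fun ξ : ℝ => m ξ + μ0*ξ + Λ0) atTop (nhds 0) := by
  have ha : 0 < μ1 - μ0 := by linarith
  have ha' : μ0 - μ1 ≠ 0 := by linarith
  have hc : 0 ≤ Λ0 * Λ1 := by positivity
  have hL : Tendsto (fun ξ : ℝ => (μ1 - μ0) * ξ + (Λ1 - Λ0)) atTop atTop :=
    tendsto_atTop_add_const_right _ _ (tendsto_id.const_mul_atTop ha)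
  have hy : ∀ ξ, (√(((μ1 - μ0) * ξ + (Λ1 - Λ0)) ^ 2 + 4 * (Λ0 * Λ1)) -
      ((μ1 - μ0) * ξ + (Λ1 - Λ0))) / 2 = m ξ + μ0 * ξ + Λ0 := by
    intro ξ
    have hqξ : q ξ = ((μ1 - μ0) * ξ + (Λ1 - Λ0)) ^ 2 + 4 * (Λ0 * Λ1) := by
      rw [hq]; ring
    rw [hm, ← hqξ]; ring
  have h0 : Tendsto (fun ξ : ℝ => m ξ + μ0*ξ + Λ0) atTop (nhds 0) :=
    ((tendsto_sqrt_sq_add_sub_half hc).comp hL).congr hy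
  have h1 : Tendsto (fun ξ : ℝ => ((μ1 - μ0) * ξ + (Λ1 - Λ0)) * (m ξ + μ0*ξ + Λ0)) atTop
      (nhds (Λ0 * Λ1)) :=
    ((tendsto_mul_sqrt_sq_add_sub_half hc).comp hL).congr fun ξ => by
      rw [Function.comp_apply, hy]
  have h2 : Tendsto (fun ξ : ℝ => ξ * (m ξ + μ0*ξ + Λ0)) atTop
      (nhds (-(Λ0*Λ1)/(μ0 - μ1))) := by
    have h := (h1.sub (h0.const_mul (Λ1 - Λ0))).div_const (μ1 - μ0)
    have hlim : (Λ0 * Λ1 - (Λ1 - Λ0) * 0) / (μ1 - μ0) = -(Λ0*Λ1)/(μ0 - μ1) := by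
      rw [← neg_sub μ0 μ1, div_neg, neg_div]; ring
    rw [hlim] at h
    refine h.congr fun ξ => ?_
    rw [div_eq_iff ha.ne']
    ring
  refine ⟨?_, h2, h0⟩
  have hne : ∀ᶠ ξ : ℝ in atTop, ξ ≠ 0 := eventually_ne_atTop 0
  rw [isLittleO_iff_tendsto' (hne.mono fun ξ hξ h => absurd h (one_div_ne_zero hξ))]
  have h := h2.sub_const (-(Λ0*Λ1)/(μ0 - μ1))
  rw [sub_self] at h
  refine h.congr' (hne.mono fun ξ hξ => ?_)
  field_simp
  ring
end

section
/- (Asymptotic expansion of m at −∞.) As ξ → −∞ one has m(ξ) = −μ1ξ − Λ1 + Λ0Λ1/(ξ(μ0 − μ1)) + o(1/ξ); in particular, ξ·(m(ξ) + μ1ξ + Λ1) tends to Λ0Λ1/(μ0 − μ1) as ξ → −∞, and m(ξ) + μ1ξ + Λ1 tends to 0 as ξ → −∞. -/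
open Filter Asymptotics

/-- The root `(√(v ^ 2 + 4 * c) - v) / 2` of `e ^ 2 + v * e = c`. -/
theorem sqrt_sub_half_quadratic {c : ℝ} (hc : 0 ≤ c) (v : ℝ) :
    ((√(v ^ 2 + 4 * c) - v) / 2) ^ 2 + v * ((√(v ^ 2 + 4 * c) - v) / 2) = c := by
  have h := Real.sq_sqrt (show 0 ≤ v ^ 2 + 4 * c by positivity)
  linear_combination h / 4

theorem tendsto_sqrt_sub_half_atTop {c : ℝ} (hc : 0 ≤ c) :
    Tendsto (fun v : ℝ => (√(v ^ 2 + 4 * c) - v) / 2) atTop (nhds 0) := by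
  refine squeeze_zero' ?_ ?_ ((tendsto_const_nhds (x := c)).div_atTop tendsto_id)
  · refine Eventually.of_forall fun v => ?_
    have h : v ≤ √(v ^ 2 + 4 * c) := Real.le_sqrt_of_sq_le (by linarith)
    linarith
  · filter_upwards [eventually_gt_atTop (0 : ℝ)] with v hv
    rw [id, le_div_iff₀ hv]
    nlinarith [sqrt_sub_half_quadratic hc v, sq_nonneg ((√(v ^ 2 + 4 * c) - v) / 2)]

/-- asymptotic expansion of m at −∞:
m(ξ) = −μ1ξ − Λ1 + Λ0Λ1/(ξ(μ0 − μ1)) + o(1/ξ) as ξ → −∞; in particular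
ξ·(m(ξ) + μ1ξ + Λ1) → Λ0Λ1/(μ0 − μ1) and m(ξ) + μ1ξ + Λ1 → 0. -/
theorem stmt_10
    (μ0 μ1 Λ0 Λ1 : ℝ) (hμ0 : μ0 < 0) (hμ1 : 0 < μ1) (hΛ0 : 0 < Λ0) (hΛ1 : 0 < Λ1)
    (q m : ℝ → ℝ)
    (hq : ∀ ξ, q ξ = (μ0 - μ1)^2 * ξ^2 + 2*(Λ0 - Λ1)*(μ0 - μ1)*ξ + (Λ0 + Λ1)^2)
    (hm : ∀ ξ, m ξ = (-(μ0 + μ1)*ξ + Real.sqrt (q ξ) - Λ0 - Λ1)/2) :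
    (fun ξ : ℝ => m ξ - (-μ1*ξ - Λ1 + Λ0*Λ1/(ξ*(μ0 - μ1)))) =o[atBot] (fun ξ : ℝ => 1/ξ) ∧
    Tendsto (fun ξ : ℝ => ξ * (m ξ + μ1*ξ + Λ1)) atBot (nhds (Λ0*Λ1/(μ0 - μ1))) ∧
    Tendsto (fun ξ : ℝ => m ξ + μ1*ξ + Λ1) atBot (nhds 0) := by
  have hd : μ0 - μ1 < 0 := by linarith
  have hc : 0 ≤ Λ0 * Λ1 := by positivity
  have hq' : ∀ ξ, q ξ = ((μ0 - μ1) * ξ + (Λ0 - Λ1)) ^ 2 + 4 * (Λ0 * Λ1) := fun ξ => by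
    rw [hq]; ring
  have he : ∀ ξ, m ξ + μ1 * ξ + Λ1 = (√(((μ0 - μ1) * ξ + (Λ0 - Λ1)) ^ 2 + 4 * (Λ0 * Λ1))
      - ((μ0 - μ1) * ξ + (Λ0 - Λ1))) / 2 := fun ξ => by
    rw [hm, hq']; ring
  have hv : Tendsto (fun ξ : ℝ => (μ0 - μ1) * ξ + (Λ0 - Λ1)) atBot atTop :=
    tendsto_atTop_add_const_right _ _ (tendsto_id.const_mul_atBot_of_neg hd)
  have h0 : Tendsto (fun ξ : ℝ => m ξ + μ1*ξ + Λ1) atBot (nhds 0) := by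
    simp only [he]
    exact (tendsto_sqrt_sub_half_atTop hc).comp hv
  have h1 : Tendsto (fun ξ : ℝ => ξ * (m ξ + μ1*ξ + Λ1)) atBot
      (nhds (Λ0*Λ1/(μ0 - μ1))) := by
    have h := (((h0.pow 2).const_sub (Λ0 * Λ1)).sub (h0.const_mul (Λ0 - Λ1))).div_const (μ0 - μ1)
    simp only [ne_eq, OfNat.ofNat_ne_zero, not_false_eq_true, zero_pow, sub_zero, mul_zero] at h
    refine h.congr fun ξ => ?_
    have hquad := sqrt_sub_half_quadratic hc ((μ0 - μ1) * ξ + (Λ0 - Λ1))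
    rw [← he] at hquad
    rw [div_eq_iff hd.ne]
    linear_combination -hquad
  refine ⟨isLittleO_iff_exists_eq_mul.2
    ⟨fun ξ => ξ * (m ξ + μ1*ξ + Λ1) - Λ0*Λ1/(μ0 - μ1), ?_, ?_⟩, h1, h0⟩
  · simpa using h1.sub_const (Λ0*Λ1/(μ0 - μ1))
  · filter_upwards [eventually_lt_atBot (0 : ℝ)] with ξ hξ
    have hξ' := hξ.ne
    have hd' := hd.ne
    simp only [Pi.mul_apply]
    field_simp
    ring
end

section
/- (Verification of the explicit solution (L01) of the Laplace-transformed telegraph system.) Fix ξ ∈ ℝ, B > 0 and real initial values a, b, and let φ, ψ, ω : ℝ → ℝ be continuous. With m = m(ξ), n = n(ξ) (so m > n), define for k ∈ {m, n} the integrals Φ_k(t) = ∫₀ᵗ φ(τ)e^{−kτ}dτ, Ψ_k(t) = ∫₀ᵗ ψ(τ)e^{−kτ}dτ, Ω_k(t) = ∫₀ᵗ ω(τ)e^{−kτ}dτ, and define L0(t) = [Λ1 μ1 e^{−ξB}(e^{nt} Ω_n(t) − e^{mt} Ω_m(t)) − e^{nt}(μ1 Λ1 Ψ_n(t) + μ0(μ1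 ξ + n + Λ1) Φ_n(t)) + e^{mt}(μ1 Λ1 Ψ_m(t) + μ0(μ1 ξ + m + Λ1) Φ_m(t)) + Λ1 (e^{mt} − e^{nt}) b + ((μ1 ξ + m + Λ1) e^{mt} − (μ1 ξ + n + Λ1) e^{nt}) a] / (m − n) and L1(t) = [μ1 e^{−ξB}((μ0 ξ + n + Λ0) e^{nt} Ω_n(t) − (μ0 ξ + m + Λ0) e^{mt} Ω_m(t)) − e^{nt}(Λ0 μ0 Φ_n(t) + μ1(μ0 ξ + n + Λ0) Ψ_n(t)) + e^{mt}(Λ0 μ0 Φ_m(t) + μ1(μ0 ξ + m + Λ0) Ψ_m(t)) + Λ0 (e^{mt} − e^{nt}) a + ((μ0 ξ + m + Λ0) e^{mt} − (μ0 ξ + n + Λ0) e^{nt}) b] / (m − n). Then L0(0) = a, L1(0) = b, and for every t ∈ ℝ the functions L0, L1 are differentiable with L0′(t) = μ0 φ(t) − (μ0 ξ + Λ0) L0(t) + Λ1 L1(t) and L1′(t) = −μ1 e^{−ξB} ω(t) + μ1 ψ(t) − (μ1 ξ + Λ1) L1(t) + Λ0 L0(t). -/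
/-- The convolution of `exp (k * ·)` with `f` solves `u' = k * u + f`. -/
theorem hasDerivAt_exp_mul_integral {f : ℝ → ℝ} (hf : Continuous f) (k t : ℝ) :
    HasDerivAt (fun t ↦ Real.exp (k * t) * ∫ τ in (0 : ℝ)..t, f τ * Real.exp (-k * τ))
      (k * (Real.exp (k * t) * ∫ τ in (0 : ℝ)..t, f τ * Real.exp (-k * τ)) + f t) t := by
  have hg : Continuous fun τ ↦ f τ * Real.exp (-k * τ) := by fun_prop
  have hE : HasDerivAt (fun t ↦ Real.exp (k * t)) (Real.exp (k * t) * k) t := by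
    simpa using ((hasDerivAt_id t).const_mul k).exp
  have hinv : Real.exp (k * t) * Real.exp (-k * t) = 1 := by
    rw [← Real.exp_add]; simp
  refine (hE.mul (hg.integral_hasStrictDerivAt 0 t).hasDerivAt).congr_deriv ?_
  linear_combination f t * hinv

/-- verification of the explicit solution (L01) of the
Laplace-transformed telegraph system: with m = m(ξ) and n = n(ξ), the
explicitly-defined functions L0, L1 satisfy L0(0) = a, L1(0) = b and the
inhomogeneous linear system
L0′(t) = μ0 φ(t) − (μ0 ξ + Λ0) L0(t) + Λ1 L1(t),
L1′(t) = −μ1 e^{−ξB} ω(t) + μ1 ψ(t) − (μ1 ξ + Λ1) L1(t) + Λ0 L0(t). -/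
theorem stmt_14
    (μ0 μ1 Λ0 Λ1 : ℝ) (hμ0 : μ0 < 0) (hμ1 : 0 < μ1) (hΛ0 : 0 < Λ0) (hΛ1 : 0 < Λ1)
    (ξ B a b : ℝ) (hB : 0 < B)
    (φ ψ ω : ℝ → ℝ) (hφ : Continuous φ) (hψ : Continuous ψ) (hω : Continuous ω)
    (q : ℝ) (hq : q = (μ0 - μ1)^2 * ξ^2 + 2*(Λ0 - Λ1)*(μ0 - μ1)*ξ + (Λ0 + Λ1)^2)
    (m n : ℝ)
    (hm : m = (-(μ0 + μ1)*ξ + Real.sqrt q - Λ0 - Λ1)/2)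
    (hn : n = (-(μ0 + μ1)*ξ - Real.sqrt q - Λ0 - Λ1)/2)
    (Φ Ψ Ω : ℝ → ℝ → ℝ)
    (hΦ : ∀ k t, Φ k t = ∫ τ in (0:ℝ)..t, φ τ * Real.exp (-k*τ))
    (hΨ : ∀ k t, Ψ k t = ∫ τ in (0:ℝ)..t, ψ τ * Real.exp (-k*τ))
    (hΩ : ∀ k t, Ω k t = ∫ τ in (0:ℝ)..t, ω τ * Real.exp (-k*τ))
    (L0 L1 : ℝ → ℝ)
    (hL0 : ∀ t, L0 t =
      (Λ1*μ1*Real.exp (-ξ*B) * (Real.exp (n*t) * Ω n t - Real.exp (m*t) * Ω m t)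
       - Real.exp (n*t) * (μ1*Λ1*Ψ n t + μ0*(μ1*ξ + n + Λ1)*Φ n t)
       + Real.exp (m*t) * (μ1*Λ1*Ψ m t + μ0*(μ1*ξ + m + Λ1)*Φ m t)
       + Λ1*(Real.exp (m*t) - Real.exp (n*t))*b
       + ((μ1*ξ + m + Λ1)*Real.exp (m*t) - (μ1*ξ + n + Λ1)*Real.exp (n*t))*a)
      / (m - n))
    (hL1 : ∀ t, L1 t =
      (μ1*Real.exp (-ξ*B) * ((μ0*ξ + n + Λ0)*Real.exp (n*t) * Ω n t
                             - (μ0*ξ + m + Λ0)*Real.exp (m*t) * Ω m t)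
       - Real.exp (n*t) * (Λ0*μ0*Φ n t + μ1*(μ0*ξ + n + Λ0)*Ψ n t)
       + Real.exp (m*t) * (Λ0*μ0*Φ m t + μ1*(μ0*ξ + m + Λ0)*Ψ m t)
       + Λ0*(Real.exp (m*t) - Real.exp (n*t))*a
       + ((μ0*ξ + m + Λ0)*Real.exp (m*t) - (μ0*ξ + n + Λ0)*Real.exp (n*t))*b)
      / (m - n)) :
    L0 0 = a ∧ L1 0 = b ∧
    ∀ t : ℝ,
      HasDerivAt L0 (μ0 * φ t - (μ0*ξ + Λ0) * L0 t + Λ1 * L1 t) t ∧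
      HasDerivAt L1 (-μ1*Real.exp (-ξ*B) * ω t + μ1 * ψ t
                     - (μ1*ξ + Λ1) * L1 t + Λ0 * L0 t) t := by
  have hq_pos : 0 < q := by
    rw [hq]
    nlinarith [sq_nonneg ((μ0 - μ1) * ξ + (Λ0 - Λ1)), mul_pos hΛ0 hΛ1]
  have hsq : Real.sqrt q ^ 2 = q := Real.sq_sqrt hq_pos.le
  have hmn : m - n ≠ 0 := by
    have : m - n = Real.sqrt q := by rw [hm, hn]; ring
    rw [this]
    exact (Real.sqrt_pos.mpr hq_pos).ne'
  have hroot_m : (m + μ0 * ξ + Λ0) * (m + μ1 * ξ + Λ1) = Λ0 * Λ1 := by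
    rw [hm]; linear_combination hsq / 4 + hq / 4
  have hroot_n : (n + μ0 * ξ + Λ0) * (n + μ1 * ξ + Λ1) = Λ0 * Λ1 := by
    rw [hn]; linear_combination hsq / 4 + hq / 4
  refine ⟨?_, ?_, fun t ↦ ?_⟩
  · rw [hL0]
    simp only [hΦ, hΨ, hΩ, intervalIntegral.integral_same, mul_zero, Real.exp_zero]
    field_simp
    ring
  · rw [hL1]
    simp only [hΦ, hΨ, hΩ, intervalIntegral.integral_same, mul_zero, Real.exp_zero]
    field_simp
    ring
  have hE (k : ℝ) : HasDerivAt (fun t ↦ Real.exp (k * t)) (k * Real.exp (k * t)) t := by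
    simpa [mul_comm] using ((hasDerivAt_id t).const_mul k).exp
  have hdΦ (k : ℝ) : HasDerivAt (fun t ↦ Real.exp (k * t) * Φ k t)
      (k * (Real.exp (k * t) * Φ k t) + φ t) t := by
    simpa only [hΦ] using hasDerivAt_exp_mul_integral hφ k t
  have hdΨ (k : ℝ) : HasDerivAt (fun t ↦ Real.exp (k * t) * Ψ k t)
      (k * (Real.exp (k * t) * Ψ k t) + ψ t) t := by
    simpa only [hΨ] using hasDerivAt_exp_mul_integral hψ k t
  have hdΩ (k : ℝ) : HasDerivAt (fun t ↦ Real.exp (k * t) * Ω k t)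
      (k * (Real.exp (k * t) * Ω k t) + ω t) t := by
    simpa only [hΩ] using hasDerivAt_exp_mul_integral hω k t
  constructor
  · have hmode (k : ℝ) := (((((hdΨ k).sub ((hdΩ k).const_mul (Real.exp (-ξ * B)))).const_mul
      (Λ1 * μ1)).add ((hdΦ k).const_mul (μ0 * (μ1 * ξ + k + Λ1)))).add
      ((hE k).const_mul (Λ1 * b + (μ1 * ξ + k + Λ1) * a)))
    refine ((((hmode m).sub (hmode n)).div_const (m - n)).congr_of_eventuallyEq
      (Filter.Eventually.of_forall fun s ↦ ?_)).congr_deriv ?_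
    · rw [hL0]
      simp only [Pi.add_apply, Pi.sub_apply]
      ring
    · rw [hL0, hL1]
      generalize Real.exp (m * t) = x, Real.exp (n * t) = y, Real.exp (-ξ * B) = z
      field_simp
      linear_combination
        x * (μ0 * Φ m t + a) * hroot_m
          - y * (μ0 * Φ n t + a) * hroot_n
  · have hmode (k : ℝ) := (((((hdΨ k).sub ((hdΩ k).const_mul (Real.exp (-ξ * B)))).const_mul
      (μ1 * (μ0 * ξ + k + Λ0))).add ((hdΦ k).const_mul (Λ0 * μ0))).add
      ((hE k).const_mul (Λ0 * a + (μ0 * ξ + k + Λ0) * b)))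
    refine ((((hmode m).sub (hmode n)).div_const (m - n)).congr_of_eventuallyEq
      (Filter.Eventually.of_forall fun s ↦ ?_)).congr_deriv ?_
    · rw [hL1]
      simp only [Pi.add_apply, Pi.sub_apply]
      ring
    · rw [hL0, hL1]
      generalize Real.exp (m * t) = x, Real.exp (n * t) = y, Real.exp (-ξ * B) = z
      field_simp
      linear_combination
        x * (μ1 * (Ψ m t - z * Ω m t) + b) * hroot_m
          - y * (μ1 * (Ψ n t - z * Ω n t) + b) * hroot_n
end
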